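/- Let m, n, r be positive integers with 2r ≤ min(m,n), let G ∈ ℝ^{m×n} have singular values σ_1 ≥ σ_2 ≥ …, with SVD blocks U_{1,r}, V_{r,2r}, and let α ∈ ℝ, α ≠ 0. Then ΔW = α U_{1,r} V_{r,2r}^T has rank exactly r (so ΔW ∈ M_r), and ΔW maximizes ‖P_{T_{ΔW'} M_r} G‖_F² over all ΔW' ∈ M_r, with ‖P_{T_{ΔW} M_r} G‖_F² = σ_1² + σ_2² + … + σ_{2r}². -/

import Mathlib

open Matrix
open scoped BigOperators

noncomputable section

/-- Squared Frobenius norm `‖Y‖_F² = tr(Yᵀ Y)`. -/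
def frobSq {m n : ℕ} (Y : Matrix (Fin m) (Fin n) ℝ) : ℝ := (Yᵀ * Y).trace

/-- Frobenius inner product `⟨Y, Z⟩ = tr(Yᵀ Z)`. -/
def frobInner {m n : ℕ} (Y Z : Matrix (Fin m) (Fin n) ℝ) : ℝ := (Yᵀ * Z).trace

/-- The fixed-rank manifold `M_r`: real `m×n` matrices of rank exactly `r`. -/
def Mrank (m n r : ℕ) : Set (Matrix (Fin m) (Fin n) ℝ) := {X | X.rank = r}

/-- The tangent space of `M_r` at a point `X = A_L Bᵀ = A B_Rᵀ` (with `A_L, B_R` having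
orthonormal columns): `{Ȧ B_Rᵀ + A_L Ḃᵀ : A_Lᵀ Ȧ = 0}`. -/
def tangentSet {m n r : ℕ} (AL : Matrix (Fin m) (Fin r) ℝ) (BR : Matrix (Fin n) (Fin r) ℝ) :
    Set (Matrix (Fin m) (Fin n) ℝ) :=
  {ξ | ∃ Ad : Matrix (Fin m) (Fin r) ℝ, ∃ Bd : Matrix (Fin n) (Fin r) ℝ,
    ALᵀ * Ad = 0 ∧ ξ = Ad * BRᵀ + AL * Bdᵀ}

/-- `(A_L, B_R)` is an orthonormal-factor pair for `X`: both have orthonormal columns and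
`X = A_L Bᵀ = A B_Rᵀ` for some `B`, `A`. -/
def IsONFact {m n r : ℕ} (X : Matrix (Fin m) (Fin n) ℝ)
    (AL : Matrix (Fin m) (Fin r) ℝ) (BR : Matrix (Fin n) (Fin r) ℝ) : Prop :=
  ALᵀ * AL = 1 ∧ BRᵀ * BR = 1 ∧
  (∃ B : Matrix (Fin n) (Fin r) ℝ, X = AL * Bᵀ) ∧
  (∃ A : Matrix (Fin m) (Fin r) ℝ, X = A * BRᵀ)

/-- The orthogonal projection (w.r.t. the Frobenius inner product) onto the tangent space
determined by `(A_L, B_R)`: `P Z = Z - (I - A_L A_Lᵀ) Z (I - B_R B_Rᵀ)`. -/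
def projT {m n r : ℕ} (AL : Matrix (Fin m) (Fin r) ℝ) (BR : Matrix (Fin n) (Fin r) ℝ)
    (Z : Matrix (Fin m) (Fin n) ℝ) : Matrix (Fin m) (Fin n) ℝ :=
  Z - (1 - AL * ALᵀ) * Z * (1 - BR * BRᵀ)

/-- Column block `U[:, off : off + r]` of a matrix `U`. -/
def colBlock {m k : ℕ} (U : Matrix (Fin m) (Fin k) ℝ) (off r : ℕ) (h : off + r ≤ k) :
    Matrix (Fin m) (Fin r) ℝ :=
  fun i j => U i ⟨off + (j : ℕ), by omega⟩

/-- The rectangular diagonal matrix of singular values. -/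
def svdDiag (m n : ℕ) (σ : ℕ → ℝ) : Matrix (Fin m) (Fin n) ℝ :=
  fun i j => if (i : ℕ) = (j : ℕ) then σ (i : ℕ) else 0

theorem aux_proj_exists {m : ℕ} {ι : Type} [DecidableEq ι] (f : ι → Fin m → ℝ) (S : Finset ι) :
    ∃ R : Matrix (Fin m) (Fin m) ℝ, Rᵀ = R ∧ R * R = R ∧ R.trace ≤ (S.card : ℝ) ∧
      ∀ i ∈ S, R *ᵥ f i = f i := by
  induction S using Finset.induction_on with
  | empty => exact ⟨0, by simp, by simp, by simp, by simp⟩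
  | insert a S ha ih =>
    obtain ⟨R, h1, h2, h3, h4⟩ := ih
    rw [Finset.card_insert_of_notMem ha]
    push_cast
    by_cases hv : f a - R *ᵥ f a = 0
    · refine ⟨R, h1, h2, by linarith, ?_⟩
      intro i hi
      rcases Finset.mem_insert.1 hi with rfl | hi
      · exact (sub_eq_zero.1 hv).symm
      · exact h4 i hi
    · set v := f a - R *ᵥ f a with hvdef
      have hvv : v ⬝ᵥ v ≠ 0 := fun h => hv (dotProduct_self_eq_zero.1 h)
      have hRv : R *ᵥ v = 0 := by
        rw [hvdef, mulVec_sub, mulVec_mulVec, h2, sub_self]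
      have hvR : v ᵥ* R = 0 := by
        rw [← h1, vecMul_transpose, hRv]
      have hvf : ∀ x : Fin m → ℝ, R *ᵥ x = x → v ⬝ᵥ x = 0 := by
        intro x hx
        rw [← hx, dotProduct_mulVec, hvR, zero_dotProduct]
      have hva : v ⬝ᵥ f a = v ⬝ᵥ v := by
        have : f a = v + R *ᵥ f a := by rw [hvdef]; abel
        rw [this, dotProduct_add, dotProduct_mulVec, hvR, zero_dotProduct, add_zero]
      refine ⟨R + (v ⬝ᵥ v)⁻¹ • vecMulVec v v, ?_, ?_, ?_, ?_⟩
      · rw [transpose_add, transpose_smul, h1, transpose_vecMulVec]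
      · rw [Matrix.add_mul, Matrix.mul_add, Matrix.mul_add, h2, Matrix.mul_smul, Matrix.smul_mul, Matrix.smul_mul, Matrix.mul_smul,
          mul_vecMulVec, vecMulVec_mul, hRv, hvR, vecMulVec_mul_vecMulVec]
        ext i j
        simp [vecMulVec_apply]
        field_simp
        exact Or.inl trivial
      · rw [trace_add, trace_smul, trace_vecMulVec, smul_eq_mul, inv_mul_cancel₀ hvv]
        linarith
      · intro i hi
        rw [add_mulVec, smul_mulVec, vecMulVec_mulVec]
        rcases Finset.mem_insert.1 hi with rfl | hi
        · rw [hva]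
          have hk : ∀ k, v k = f i k - (R *ᵥ f i) k := fun k => rfl
          clear_value v
          ext k
          simp only [Pi.add_apply, Pi.smul_apply, MulOpposite.smul_eq_mul_unop,
            MulOpposite.unop_op, smul_eq_mul]
          have := hk k
          field_simp
          linarith
        · rw [hvf _ (h4 i hi), h4 i hi]
          simp

theorem aux_frob_nonneg {m n : ℕ} (Y : Matrix (Fin m) (Fin n) ℝ) : 0 ≤ frobSq Y := by
  unfold frobSq
  rw [trace]
  refine Finset.sum_nonneg fun i _ => ?_
  simp only [diag_apply, mul_apply, transpose_apply]
  exact Finset.sum_nonneg fun j _ => mul_self_nonneg _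

theorem aux_frob_sub {m n : ℕ} (Y Z : Matrix (Fin m) (Fin n) ℝ) :
    frobSq (Y - Z) = frobSq Y - 2 * (Yᵀ * Z).trace + frobSq Z := by
  unfold frobSq
  have : (Zᵀ * Y).trace = (Yᵀ * Z).trace := by
    rw [← trace_transpose, transpose_mul, transpose_transpose]
  rw [transpose_sub, Matrix.sub_mul, Matrix.mul_sub, Matrix.mul_sub, trace_sub, trace_sub, trace_sub, this]
  ring

theorem aux_svd_diag {m n : ℕ} (τ : ℕ → ℝ) (h : ∀ i, min m n ≤ i → τ i = 0) :
    svdDiag m n τ * (svdDiag m n τ)ᵀ = diagonal (fun i : Fin m => τ i ^ 2) := by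
  ext i k
  rw [mul_apply, diagonal_apply]
  simp only [transpose_apply, svdDiag]
  by_cases hi : (i : ℕ) < n
  · rw [Finset.sum_eq_single (⟨i, hi⟩ : Fin n)]
    · by_cases hik : i = k
      · subst hik; simp [sq]
      · have : ¬ (k : ℕ) = i := fun h => hik (Fin.ext h.symm)
        simp [hik, this]
    · intro b _ hb
      have : ¬ (i : ℕ) = b := fun h => hb (Fin.ext h.symm)
      simp [this]
    · simp
  · have h0 : τ i = 0 := h _ (by omega)
    simp [h0]

/-- `‖R U D Vᵀ‖²` as a weighted sum of squared singular values. -/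
theorem aux_frob_R {m n : ℕ} (U : Matrix (Fin m) (Fin m) ℝ) (V : Matrix (Fin n) (Fin n) ℝ)
    (hV : Vᵀ * V = 1) (τ : ℕ → ℝ) (h : ∀ i, min m n ≤ i → τ i = 0)
    (R : Matrix (Fin m) (Fin m) ℝ) (h1 : Rᵀ = R) (h2 : R * R = R) :
    frobSq (R * (U * svdDiag m n τ * Vᵀ)) = ∑ i : Fin m, (Uᵀ * R * U) i i * τ i ^ 2 := by
  unfold frobSq
  set D := svdDiag m n τ with hD
  have e1 : (R * (U * D * Vᵀ))ᵀ * (R * (U * D * Vᵀ)) = V * (Dᵀ * (Uᵀ * R * U) * D * Vᵀ) := by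
    simp only [transpose_mul, transpose_transpose, h1, Matrix.mul_assoc]
    rw [← Matrix.mul_assoc R R, h2]
  rw [e1, trace_mul_comm, Matrix.mul_assoc _ Vᵀ V, hV, Matrix.mul_one, Matrix.mul_assoc,
    trace_mul_comm, Matrix.mul_assoc, hD, aux_svd_diag τ h, trace]
  simp only [diag_apply, mul_diagonal]

theorem aux_range_sum {m k : ℕ} (h : k ≤ m) (f : ℕ → ℝ) :
    ∑ i : Fin m, (if (i : ℕ) < k then f i else 0) = ∑ i ∈ Finset.range k, f i := by
  rw [Fin.sum_univ_eq_sum_range (fun i => if i < k then f i else 0) m, ← Finset.sum_filter]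
  congr 1
  ext i
  simp
  omega

theorem aux_weighted {m k : ℕ} (h : k ≤ m) (σ : ℕ → ℝ) (hmono : ∀ i j : ℕ, i ≤ j → σ j ≤ σ i)
    (hnn : ∀ i, 0 ≤ σ i) (p : Fin m → ℝ) (p0 : ∀ i, 0 ≤ p i) (p1 : ∀ i, p i ≤ 1)
    (ps : ∑ i, p i ≤ k) :
    ∑ i : Fin m, p i * σ i ^ 2 ≤ ∑ i ∈ Finset.range k, σ i ^ 2 := by
  have e1 : ∑ i : Fin m, p i * σ i ^ 2
      = ∑ i : Fin m, p i * (σ i ^ 2 - σ k ^ 2) + (∑ i, p i) * σ k ^ 2 := by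
    rw [Finset.sum_mul, ← Finset.sum_add_distrib]
    exact Finset.sum_congr rfl fun i _ => by ring
  have e2 : ∑ i : Fin m, p i * (σ i ^ 2 - σ k ^ 2)
      ≤ ∑ i : Fin m, (if (i : ℕ) < k then (fun j => σ j ^ 2 - σ k ^ 2) (i : ℕ) else 0) := by
    refine Finset.sum_le_sum fun i _ => ?_
    split_ifs with hi
    · have := pow_le_pow_left₀ (hnn k) (hmono i k hi.le) 2
      have := p1 i
      simp only
      nlinarith
    · have := pow_le_pow_left₀ (hnn i) (hmono k i (by omega)) 2
      have := p0 i
      nlinarith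
  rw [aux_range_sum h (fun j => σ j ^ 2 - σ k ^ 2), Finset.sum_sub_distrib] at e2
  simp at e2
  have e3 : (∑ i, p i) * σ k ^ 2 ≤ k * σ k ^ 2 := by
    gcongr
  linarith

theorem aux_upper {m n r : ℕ} (h2r : 2 * r ≤ min m n)
    (U : Matrix (Fin m) (Fin m) ℝ) (V : Matrix (Fin n) (Fin n) ℝ) (σ : ℕ → ℝ)
    (hU : Uᵀ * U = 1) (hV : Vᵀ * V = 1)
    (hσmono : ∀ i j : ℕ, i ≤ j → σ j ≤ σ i)
    (hσnonneg : ∀ i, 0 ≤ σ i)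
    (hσzero : ∀ i, min m n ≤ i → σ i = 0)
    (A : Matrix (Fin m) (Fin r) ℝ) (B : Matrix (Fin n) (Fin r) ℝ)
    (hA : Aᵀ * A = 1) (hB : Bᵀ * B = 1) :
    frobSq (projT A B (U * svdDiag m n σ * Vᵀ)) ≤ ∑ i ∈ Finset.range (2 * r), σ i ^ 2 := by
  set G := U * svdDiag m n σ * Vᵀ with hG
  set P := A * Aᵀ with hP
  set Q := B * Bᵀ with hQ
  have hPt : Pᵀ = P := by simp [hP, transpose_mul]
  have hQt : Qᵀ = Q := by simp [hQ, transpose_mul]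
  have hPP : P * P = P := by
    rw [hP, Matrix.mul_assoc, ← Matrix.mul_assoc Aᵀ, hA, Matrix.one_mul]
  have hQQ : Q * Q = Q := by
    rw [hQ, Matrix.mul_assoc, ← Matrix.mul_assoc Bᵀ, hB, Matrix.one_mul]
  obtain ⟨R, h1, h2, h3, h4⟩ := aux_proj_exists
    (fun j => (fromCols A ((1 - P) * G * B)).col j) (Finset.univ : Finset (Fin r ⊕ Fin r))
  have hRA : R * A = A := by
    ext i j
    have := congrFun (h4 (Sum.inl j) (Finset.mem_univ _)) i
    simpa [mulVec, dotProduct, mul_apply] using this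
  have hRB : R * ((1 - P) * G * B) = (1 - P) * G * B := by
    ext i j
    have := congrFun (h4 (Sum.inr j) (Finset.mem_univ _)) i
    simp only [mulVec, dotProduct, col_apply, fromCols_apply_inr] at this
    rw [mul_apply]
    exact this
  set X := projT A B G with hX
  have hXe : X = G - (1 - P) * G * (1 - Q) := rfl
  have hX2 : X = A * (Aᵀ * G) + ((1 - P) * G * B) * Bᵀ := by
    rw [hXe, ← Matrix.mul_assoc A, Matrix.mul_assoc _ B, ← hP, ← hQ]
    simp only [Matrix.mul_sub, Matrix.sub_mul, Matrix.mul_one, Matrix.one_mul]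
    abel
  have hRX : R * X = X := by
    rw [hX2, Matrix.mul_add, ← Matrix.mul_assoc R A, hRA, ← Matrix.mul_assoc R _ Bᵀ, hRB]
  have hXR : Xᵀ * R = Xᵀ := by
    rw [← h1, ← transpose_mul, hRX]
  -- orthogonality
  have hort : (Xᵀ * G).trace = frobSq X := by
    unfold frobSq
    have e : G = X + (1 - P) * G * (1 - Q) := by rw [hXe]; abel
    have z : (Xᵀ * ((1 - P) * G * (1 - Q))).trace = 0 := by
      have hp : (1 - P) * (1 - P) = 1 - P := by
        rw [Matrix.mul_sub, Matrix.sub_mul, Matrix.sub_mul, hPP]; simp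
      have hq : (1 - Q) * (1 - Q) = 1 - Q := by
        rw [Matrix.mul_sub, Matrix.sub_mul, Matrix.sub_mul, hQQ]; simp
      have hz : (1 - P) * X * (1 - Q) = 0 := by
        rw [hXe, Matrix.mul_sub (1 - P), Matrix.sub_mul _ _ (1 - Q)]
        have : (1 - P) * ((1 - P) * G * (1 - Q)) * (1 - Q)
            = ((1 - P) * (1 - P)) * G * ((1 - Q) * (1 - Q)) := by
          simp only [Matrix.mul_assoc]
        rw [this, hp, hq, sub_self]
      have hz' := congrArg transpose hz
      simp only [transpose_mul, transpose_sub, transpose_one, hPt, hQt, transpose_zero] at hz'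
      rw [← Matrix.mul_assoc, trace_mul_comm, ← Matrix.mul_assoc, ← Matrix.mul_assoc,
        Matrix.mul_assoc (1 - Q), hz', Matrix.zero_mul, trace_zero]
    conv_lhs => rw [e]
    rw [Matrix.mul_add, trace_add, z, add_zero]
  have key : frobSq X ≤ frobSq (R * G) := by
    have := aux_frob_nonneg (X - R * G)
    rw [aux_frob_sub, ← Matrix.mul_assoc, hXR, hort] at this
    linarith
  refine key.trans ?_
  rw [hG, aux_frob_R U V hV σ hσzero R h1 h2]
  have hUU : U * Uᵀ = 1 := mul_eq_one_comm.1 hU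
  set S := Uᵀ * R * U with hS
  have hSt : Sᵀ = S := by simp [hS, transpose_mul, h1, Matrix.mul_assoc]
  have hSS : S * S = S := by
    have : S * S = Uᵀ * (R * ((U * Uᵀ) * (R * U))) := by simp only [hS, Matrix.mul_assoc]
    rw [this, hUU, Matrix.one_mul, ← Matrix.mul_assoc R, h2, hS, Matrix.mul_assoc]
  have hsq : ∀ i, S i i ^ 2 ≤ S i i := by
    intro i
    have e : S i i = ∑ k, S i k ^ 2 := by
      conv_lhs => rw [← hSS]
      rw [mul_apply]
      refine Finset.sum_congr rfl fun k _ => ?_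
      have : S k i = S i k := by
        conv_lhs => rw [← hSt]
        rfl
      rw [this, sq]
    conv_rhs => rw [e]
    exact Finset.single_le_sum (f := fun k => S i k ^ 2) (fun k _ => sq_nonneg _)
      (Finset.mem_univ i)
  refine aux_weighted (by omega) σ hσmono hσnonneg (fun i => S i i) ?_ ?_ ?_
  · intro i
    exact (sq_nonneg _).trans (hsq i)
  · intro i
    have := hsq i
    change S i i ≤ 1
    nlinarith
  · have : ∑ i, S i i = R.trace := by
      change S.trace = _
      rw [hS, trace_mul_comm, ← Matrix.mul_assoc, hUU, Matrix.one_mul]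
    rw [this]
    refine h3.trans (le_of_eq ?_)
    simp
    ring

theorem aux_colBlock_on {m k : ℕ} (U : Matrix (Fin m) (Fin k) ℝ) (hU : Uᵀ * U = 1)
    (off r : ℕ) (h : off + r ≤ k) : (colBlock U off r h)ᵀ * colBlock U off r h = 1 := by
  ext i j
  have := congrFun (congrFun hU ⟨off + i, by omega⟩) ⟨off + j, by omega⟩
  rw [mul_apply] at this ⊢
  refine this.trans ?_
  simp [one_apply, Fin.ext_iff]

theorem aux_colBlock_proj {m k : ℕ} (U : Matrix (Fin m) (Fin k) ℝ)
    (off r : ℕ) (h : off + r ≤ k) : colBlock U off r h * (colBlock U off r h)ᵀ =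
      U * diagonal (fun i : Fin k => if off ≤ (i : ℕ) ∧ (i : ℕ) < off + r then (1 : ℝ) else 0)
        * Uᵀ := by
  ext i j
  rw [mul_apply, mul_apply]
  simp only [mul_diagonal, transpose_apply, colBlock]
  refine Finset.sum_of_injOn (fun x : Fin r => (⟨off + x, by omega⟩ : Fin k)) ?_ ?_ ?_ ?_
  · intro a _ b _ hab
    simpa [Fin.ext_iff] using hab
  · intro a _; simp
  · intro a _ ha
    rw [if_neg]
    · simp
    · rintro ⟨h1, h2⟩
      apply ha
      refine ⟨⟨a - off, by omega⟩, by simp, ?_⟩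
      ext
      simp
      omega
  · intro a _
    simp

theorem aux_value {m n r : ℕ} (h2r : 2 * r ≤ min m n)
    (U : Matrix (Fin m) (Fin m) ℝ) (V : Matrix (Fin n) (Fin n) ℝ) (σ : ℕ → ℝ)
    (hU : Uᵀ * U = 1) (hV : Vᵀ * V = 1)
    (h1 : 0 + r ≤ m) (h2 : r + r ≤ n) :
    frobSq (projT (colBlock U 0 r h1) (colBlock V r r h2) (U * svdDiag m n σ * Vᵀ))
      = ∑ i ∈ Finset.range (2 * r), σ i ^ 2 := by
  have hUU : U * Uᵀ = 1 := mul_eq_one_comm.1 hU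
  have hVV : V * Vᵀ = 1 := mul_eq_one_comm.1 hV
  set τ : ℕ → ℝ := fun i => if i < 2 * r then σ i else 0 with hτ
  have hproj : projT (colBlock U 0 r h1) (colBlock V r r h2) (U * svdDiag m n σ * Vᵀ)
      = U * svdDiag m n τ * Vᵀ := by
    unfold projT
    rw [aux_colBlock_proj, aux_colBlock_proj]
    set E := diagonal (fun i : Fin m => if 0 ≤ (i : ℕ) ∧ (i : ℕ) < 0 + r then (1 : ℝ) else 0)
      with hE
    set F := diagonal (fun i : Fin n => if r ≤ (i : ℕ) ∧ (i : ℕ) < r + r then (1 : ℝ) else 0)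
      with hF
    set D := svdDiag m n σ with hD
    have e1 : (1 - U * E * Uᵀ) = U * (1 - E) * Uᵀ := by
      rw [Matrix.mul_sub, Matrix.sub_mul, Matrix.mul_one, hUU]
    have e2 : (1 - V * F * Vᵀ) = V * (1 - F) * Vᵀ := by
      rw [Matrix.mul_sub, Matrix.sub_mul, Matrix.mul_one, hVV]
    have e3 : U * (1 - E) * Uᵀ * (U * D * Vᵀ) * (V * (1 - F) * Vᵀ)
        = U * ((1 - E) * D * (1 - F)) * Vᵀ := by
      calc _ = U * (1 - E) * (Uᵀ * U) * D * (Vᵀ * V) * (1 - F) * Vᵀ := by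
            simp only [Matrix.mul_assoc]
        _ = _ := by rw [hU, hV]; simp only [Matrix.mul_one, Matrix.mul_assoc]
    have e4 : D - (1 - E) * D * (1 - F) = svdDiag m n τ := by
      have d1 : (1 - E) = diagonal (fun i : Fin m =>
          1 - if 0 ≤ (i : ℕ) ∧ (i : ℕ) < 0 + r then (1 : ℝ) else 0) := by
        rw [hE, ← diagonal_one, diagonal_sub]
      have d2 : (1 - F) = diagonal (fun i : Fin n =>
          1 - if r ≤ (i : ℕ) ∧ (i : ℕ) < r + r then (1 : ℝ) else 0) := by
        rw [hF, ← diagonal_one, diagonal_sub]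
      rw [d1, d2]
      ext i j
      rw [Matrix.sub_apply, mul_diagonal, diagonal_mul, hD]
      simp only [svdDiag, hτ]
      split_ifs <;> first | (exfalso; omega) | simp
    rw [e1, e2, e3, ← e4, Matrix.mul_sub U, Matrix.sub_mul _ _ Vᵀ]
  have hz : ∀ i, min m n ≤ i → τ i = 0 := by
    intro i hi
    simp only [hτ]
    rw [if_neg (by omega)]
  rw [hproj]
  have := aux_frob_R U V hV τ hz 1 (by simp) (by simp)
  rw [Matrix.one_mul, Matrix.mul_one, hU] at this
  rw [this, ← aux_range_sum (m := m) (by omega : 2 * r ≤ m) (fun i => σ i ^ 2)]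
  refine Finset.sum_congr rfl fun i _ => ?_
  simp only [hτ, one_apply_eq, one_mul]
  split_ifs <;> simp

/-- For `α ≠ 0`, `ΔW = α U_{1,r} V_{r,2r}ᵀ` has rank exactly `r`
(so `ΔW ∈ M_r`) and maximizes `‖P_{T_{ΔW'} M_r} G‖_F²` over `ΔW' ∈ M_r`, with value
`σ₁² + … + σ_{2r}²`.  (Its tangent space is the one determined by the orthonormal pair
`(U_{1,r}, V_{r,2r})`.) -/
theorem conv_init_optimal
    {m n r : ℕ} (hm : 0 < m) (hn : 0 < n) (hr : 0 < r) (h2r : 2 * r ≤ min m n)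
    (G : Matrix (Fin m) (Fin n) ℝ)
    (U : Matrix (Fin m) (Fin m) ℝ) (V : Matrix (Fin n) (Fin n) ℝ) (σ : ℕ → ℝ)
    (hU : Uᵀ * U = 1) (hV : Vᵀ * V = 1)
    (hσmono : ∀ i j : ℕ, i ≤ j → σ j ≤ σ i)
    (hσnonneg : ∀ i, 0 ≤ σ i)
    (hσzero : ∀ i, min m n ≤ i → σ i = 0)
    (hG : G = U * svdDiag m n σ * Vᵀ)
    (α : ℝ) (hα : α ≠ 0)
    (ΔW : Matrix (Fin m) (Fin n) ℝ)
    (hΔW : ΔW = α • (colBlock U 0 r (by omega) * (colBlock V r r (by omega))ᵀ)) :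
    ΔW ∈ Mrank m n r ∧
    IsONFact ΔW (colBlock U 0 r (by omega)) (colBlock V r r (by omega)) ∧
    (∀ ΔW' ∈ Mrank m n r, ∀ (AL' : Matrix (Fin m) (Fin r) ℝ) (BR' : Matrix (Fin n) (Fin r) ℝ),
      IsONFact ΔW' AL' BR' →
      frobSq (projT AL' BR' G) ≤
        frobSq (projT (colBlock U 0 r (by omega)) (colBlock V r r (by omega)) G)) ∧
    frobSq (projT (colBlock U 0 r (by omega)) (colBlock V r r (by omega)) G) =
      ∑ i ∈ Finset.range (2 * r), σ i ^ 2 := by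
  have oU := aux_colBlock_on U hU 0 r (by omega)
  have oV := aux_colBlock_on V hV r r (by omega)
  have hval := aux_value h2r U V σ hU hV (by omega) (by omega)
  rw [← hG] at hval
  refine ⟨?_, ⟨oU, oV, ?_, ?_⟩, ?_, hval⟩
  · change ΔW.rank = r
    apply le_antisymm
    · rw [hΔW, ← Matrix.smul_mul]
      refine (rank_mul_le_left _ _).trans ?_
      simpa using rank_le_card_width (α • colBlock U 0 r (by omega : 0 + r ≤ m))
    · have e : (α⁻¹ • (colBlock U 0 r (by omega : 0 + r ≤ m))ᵀ) * ΔW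
          * (colBlock V r r (by omega : r + r ≤ n)) = 1 := by
        rw [hΔW, Matrix.mul_smul, Matrix.smul_mul, Matrix.smul_mul, Matrix.smul_mul, smul_smul, mul_inv_cancel₀ hα, one_smul,
          ← Matrix.mul_assoc, oU, Matrix.one_mul, oV]
      have h1 : (1 : Matrix (Fin r) (Fin r) ℝ).rank = r := by simp
      rw [← h1]
      conv_lhs => rw [← e]
      exact (rank_mul_le_left _ _).trans (rank_mul_le_right _ _)
  · refine ⟨α • colBlock V r r (by omega), ?_⟩
    rw [hΔW, transpose_smul, Matrix.mul_smul]
  · refine ⟨α • colBlock U 0 r (by omega), ?_⟩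
    rw [hΔW, Matrix.smul_mul]
  · intro X _ A B hAB
    rw [hval, hG]
    exact aux_upper h2r U V σ hU hV hσmono hσnonneg hσzero A B hAB.1 hAB.2.1
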